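/- arXiv:2303.02380 — 6 statements merged into one kernel-verified Lean document; each statement's English description precedes it below -/
import Mathlib

section
/- Fix q ∈ (0,1) and x₀ ∈ ℤ≥0. For k ≥ 1 and a word ε = (ε₁,…,ε_k) ∈ {0,−1}^k, let P(x₀;ε) = ∏_{l=1}^{k} Υ₁(s_{l−1}, s_l), where s_l = x₀ + ε₁ + … + ε_l and s₀ = x₀. Then for every 1 ≤ i ≤ k−1, if ε′ is obtained from ε by interchanging ε_i and ε_{i+1}, one has P(x₀;ε) = q^{ε_i − ε_{i+1}} · P(x₀;ε′). In particular, transposing a neighboring pair of steps (down, straight) into (straight, down) multiplies the probability of the trajectory by q. -/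
/-- The one-step transition matrix of the `q`-exchangeable random walk on `ℤ`:
`Υ₁(x,x) = q^x`, `Υ₁(x,x−1) = 1 − q^x` for `x ≥ 0`, and `0` otherwise. -/
noncomputable def Ups1 (q : ℝ) (x y : ℤ) : ℝ :=
  if 0 ≤ x ∧ y = x then q ^ x
  else if 0 ≤ x ∧ y = x - 1 then 1 - q ^ x
  else 0

/-- The position of the walk after `l` steps: `s_l = x₀ + ε₁ + … + ε_l`. -/
def traj (x₀ : ℤ) (ε : ℕ → ℤ) (l : ℕ) : ℤ := x₀ + ∑ j ∈ Finset.Icc 1 l, ε j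

theorem traj_succ (x₀ : ℤ) (ε : ℕ → ℤ) (l : ℕ) :
    traj x₀ ε (l + 1) = traj x₀ ε l + ε (l + 1) := by
  simp only [traj, Finset.sum_Icc_succ_top (Nat.le_add_left 1 l), add_assoc]

/-- Interchanging two steps changes the position of the walk only in between them. -/
theorem traj_eq_of_swap (x₀ : ℤ) {ε ε' : ℕ → ℤ} {n : ℕ}
    (h1 : ε' (n + 1) = ε (n + 2)) (h2 : ε' (n + 2) = ε (n + 1))
    (h3 : ∀ l, l ≠ n + 1 → l ≠ n + 2 → ε' l = ε l) {l : ℕ} (hl : l ≠ n + 1) :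
    traj x₀ ε' l = traj x₀ ε l := by
  have before : ∀ m ≤ n, traj x₀ ε' m = traj x₀ ε m := fun m hm ↦ by
    unfold traj
    congr 1
    refine Finset.sum_congr rfl fun j hj ↦ ?_
    rw [Finset.mem_Icc] at hj
    exact h3 j (by omega) (by omega)
  rcases Nat.lt_or_ge n l with h | h
  · induction l, (show n + 2 ≤ l by omega) using Nat.le_induction with
    | base =>
      simp only [traj_succ, before n le_rfl, h1, h2]
      ring
    | succ m hm ih =>
      rw [traj_succ, traj_succ, ih (by omega) (by omega), h3 _ (by omega) (by omega)]
  · exact before l h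

theorem Ups1_of_neg (q : ℝ) {x : ℤ} (hx : x < 0) (y : ℤ) : Ups1 q x y = 0 := by
  simp [Ups1, not_le.mpr hx]

theorem Ups1_self (q : ℝ) {x : ℤ} (hx : 0 ≤ x) : Ups1 q x x = q ^ x := by
  simp [Ups1, hx]

theorem Ups1_sub_one (q : ℝ) {x : ℤ} (hx : 0 ≤ x) : Ups1 q x (x - 1) = 1 - q ^ x := by
  simp [Ups1, hx]

theorem Ups1_down_straight {q : ℝ} (hq : q ≠ 0) (x : ℤ) :
    Ups1 q x x * Ups1 q x (x - 1) = q * (Ups1 q x (x - 1) * Ups1 q (x - 1) (x - 1)) := by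
  rcases lt_trichotomy x 0 with hx | rfl | hx
  · simp [Ups1_of_neg q hx]
  · simp [Ups1]
  · rw [Ups1_self q hx.le, Ups1_sub_one q hx.le, Ups1_self q (by omega), zpow_sub_one₀ hq]
    field_simp

theorem Ups1_two_steps_swap {q : ℝ} (hq : q ≠ 0) (x : ℤ) {a b : ℤ}
    (ha : a = 0 ∨ a = -1) (hb : b = 0 ∨ b = -1) :
    Ups1 q x (x + a) * Ups1 q (x + a) (x + a + b) =
      q ^ (a - b) * (Ups1 q x (x + b) * Ups1 q (x + b) (x + b + a)) := by
  have key := Ups1_down_straight hq x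
  rcases ha with rfl | rfl <;> rcases hb with rfl | rfl
  · simp
  · simpa [← sub_eq_add_neg] using key
  · simp only [← sub_eq_add_neg, add_zero, sub_zero, zpow_neg_one, key]
    field_simp
  · simp

/-- Transposing neighboring steps `ε_i, ε_{i+1}` multiplies the probability of the
trajectory of the `q`-exchangeable walk by `q^{ε_i − ε_{i+1}}`. -/
theorem stmt_0 (q : ℝ) (hq0 : 0 < q) (hq1 : q < 1) (x₀ : ℤ) (hx₀ : 0 ≤ x₀)
    (k : ℕ) (hk : 1 ≤ k) (ε ε' : ℕ → ℤ)
    (hε : ∀ l, 1 ≤ l → l ≤ k → ε l = 0 ∨ ε l = -1)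
    (i : ℕ) (hi1 : 1 ≤ i) (hik : i ≤ k - 1)
    (h1 : ε' i = ε (i + 1)) (h2 : ε' (i + 1) = ε i)
    (h3 : ∀ l, l ≠ i → l ≠ i + 1 → ε' l = ε l) :
    (∏ l ∈ Finset.Icc 1 k, Ups1 q (traj x₀ ε (l - 1)) (traj x₀ ε l))
      = q ^ (ε i - ε (i + 1)) *
        ∏ l ∈ Finset.Icc 1 k, Ups1 q (traj x₀ ε' (l - 1)) (traj x₀ ε' l) := by
  obtain ⟨n, rfl⟩ : ∃ n, i = n + 1 := ⟨i - 1, by omega⟩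
  have ht {l : ℕ} (hl : l ≠ n + 1) : traj x₀ ε' l = traj x₀ ε l :=
    traj_eq_of_swap x₀ h1 h2 h3 hl
  have hsub : ({n + 1, n + 2} : Finset ℕ) ⊆ Finset.Icc 1 k := by
    intro l hl
    simp only [Finset.mem_insert, Finset.mem_singleton] at hl
    rw [Finset.mem_Icc]
    omega
  rw [← Finset.prod_sdiff (M := ℝ) hsub, ← Finset.prod_sdiff (M := ℝ) hsub, Finset.prod_pair (by omega),
    Finset.prod_pair (by omega), mul_left_comm (q ^ _)]
  refine congr_arg₂ (· * ·) ?_ ?_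
  · refine Finset.prod_congr rfl fun l hl ↦ ?_
    simp only [Finset.mem_sdiff, Finset.mem_Icc, Finset.mem_insert, Finset.mem_singleton] at hl
    rw [ht (by omega), ht (by omega)]
  · have hn : traj x₀ ε' n = traj x₀ ε n := ht (by omega)
    simpa [traj_succ, hn, h1, h2] using Ups1_two_steps_swap hq0.ne' (traj x₀ ε n)
      (hε (n + 1) (by omega) (by omega)) (hε (n + 2) (by omega) (by omega))
end

section
/- Fix q ∈ (0,1). For integers T ≥ 0 and x, y ∈ ℤ≥0 with T ≥ x − y, the T-step transition probability of the q-exchangeable walk equals Υ₁^{(T)}(x,y) = 1_{0 ≤ y ≤ x} · (∏_{j=y+1}^{x}(1−q^j)) · q^{y(T−x+y)} · (q;q)_T / ((q;q)_{x−y} (q;q)_{T−x+y}). -/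
/-- The q-Pochhammer symbol `(a;q)_k = ∏_{i=0}^{k−1} (1 − a q^i)`. -/
noncomputable def qPoch (q a : ℝ) (k : ℕ) : ℝ := ∏ i ∈ Finset.range k, (1 - a * q ^ i)

/-- The `T`-step transition probability `Υ₁^{(T)}`, the `T`-fold matrix product of `Υ₁`
(the intermediate sum runs over `z ∈ ℤ≥0`). -/
noncomputable def Ups1T (q : ℝ) : ℕ → ℤ → ℤ → ℝ
  | 0, x, y => if x = y then 1 else 0
  | T + 1, x, y => ∑' z : ℕ, Ups1T q T x (z : ℤ) * Ups1 q (z : ℤ) y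

theorem Ups1T_succ (q : ℝ) (T x y : ℕ) :
    Ups1T q (T + 1) (x : ℤ) (y : ℤ) =
      Ups1T q T (x : ℤ) (y : ℤ) * q ^ y
        + Ups1T q T (x : ℤ) ((y + 1 : ℕ) : ℤ) * (1 - q ^ (y + 1)) := by
  have h₀ : Ups1 q (y : ℤ) (y : ℤ) = q ^ y := by simp [Ups1]
  have h₁ : Ups1 q ((y + 1 : ℕ) : ℤ) (y : ℤ) = 1 - q ^ (y + 1) := by
    rw [Ups1, if_neg (by omega), if_pos (by omega), zpow_natCast]
  rw [Ups1T, tsum_eq_sum (s := {y, y + 1}), Finset.sum_pair (by omega), h₀, h₁]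
  intro z hz
  simp only [Finset.mem_insert, Finset.mem_singleton, not_or] at hz
  rw [Ups1, if_neg (by omega), if_neg (by omega), mul_zero]

theorem Ups1T_eq_zero_of_lt (q : ℝ) (T : ℕ) :
    ∀ x y : ℕ, x < y → Ups1T q T (x : ℤ) (y : ℤ) = 0 := by
  induction T with
  | zero =>
    intro x y h
    rw [Ups1T, if_neg (by omega)]
  | succ T ih =>
    intro x y h
    rw [Ups1T_succ, ih x y h, ih x (y + 1) (by omega)]
    ring

theorem Ups1T_eq_zero_of_add_lt (q : ℝ) (T : ℕ) :
    ∀ x y : ℕ, T + y < x → Ups1T q T (x : ℤ) (y : ℤ) = 0 := by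
  induction T with
  | zero =>
    intro x y h
    rw [Ups1T, if_neg (by omega)]
  | succ T ih =>
    intro x y h
    rw [Ups1T_succ, ih x y (by omega), ih x (y + 1) (by omega)]
    ring

theorem qPoch_self_succ (q : ℝ) (k : ℕ) :
    qPoch q q (k + 1) = qPoch q q k * (1 - q ^ (k + 1)) := by
  rw [qPoch, Finset.prod_range_succ, qPoch, pow_succ' q k]

theorem qPoch_self_ne_zero {q : ℝ} (hq0 : 0 < q) (hq1 : q < 1) (k : ℕ) : qPoch q q k ≠ 0 := by
  refine Finset.prod_ne_zero_iff.mpr fun i _ => ?_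
  rw [← pow_succ']
  exact (sub_pos.mpr (pow_lt_one₀ hq0.le hq1 i.succ_ne_zero)).ne'

/-- The transition probability of making `d` down-steps and `m` pauses, cleared of denominators. -/
theorem Ups1T_add_mul_qPoch (q : ℝ) (T : ℕ) :
    ∀ y d m : ℕ, d + m = T →
      Ups1T q T ((y + d : ℕ) : ℤ) (y : ℤ) * (qPoch q q d * qPoch q q m) =
        (∏ j ∈ Finset.Icc (y + 1) (y + d), (1 - q ^ j)) * q ^ (y * m) * qPoch q q T := by
  induction T with
  | zero =>
    intro y d m h
    obtain ⟨rfl, rfl⟩ : d = 0 ∧ m = 0 := by omega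
    simp [Ups1T, qPoch]
  | succ T ih =>
    intro y d m h
    rw [Ups1T_succ, qPoch_self_succ q T]
    rcases d with _ | d
    · obtain rfl : m = T + 1 := by omega
      have hs := ih y 0 T (by omega)
      rw [Ups1T_eq_zero_of_lt q T (y + 0) (y + 1) (by omega), qPoch_self_succ q T]
      have hq : q ^ (y * (T + 1)) = q ^ (y * T) * q ^ y := by ring
      rw [hq]
      linear_combination (q ^ y * (1 - q ^ (T + 1))) * hs
    · have hd := ih (y + 1) d m (by omega)
      rw [show y + 1 + d = y + (d + 1) by ring] at hd
      have hp : ∏ j ∈ Finset.Icc (y + 1) (y + (d + 1)), (1 - q ^ j) =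
          (1 - q ^ (y + 1)) * ∏ j ∈ Finset.Icc (y + 1 + 1) (y + (d + 1)), (1 - q ^ j) := by
        rw [Finset.Icc_add_one_left_eq_Ioc (y + 1)]
        exact (Finset.mul_prod_Ioc_eq_prod_Icc (f := fun j => 1 - q ^ j) (by omega)).symm
      rcases m with _ | m
      · obtain rfl : d = T := by omega
        rw [Ups1T_eq_zero_of_add_lt q d (y + (d + 1)) y (by omega), qPoch_self_succ q d, hp]
        simp only [mul_zero, pow_zero] at hd ⊢
        linear_combination ((1 - q ^ (y + 1)) * (1 - q ^ (d + 1))) * hd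
      · have hs := ih y (d + 1) m (by omega)
        obtain rfl : T = d + m + 1 := by omega
        rw [hp] at hs ⊢
        rw [qPoch_self_succ q d] at hs ⊢
        rw [qPoch_self_succ q m] at hd ⊢
        have h₁ : q ^ (y * (m + 1)) = q ^ (y * m) * q ^ y := by ring
        have h₂ : q ^ ((y + 1) * (m + 1)) = q ^ (y * m) * q ^ y * q ^ (m + 1) := by ring
        have h₃ : q ^ (d + m + 1 + 1) = q ^ (d + 1) * q ^ (m + 1) := by ring
        rw [h₂] at hd
        rw [h₁, h₃]
        linear_combination (q ^ y * (1 - q ^ (m + 1))) * hs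
          + ((1 - q ^ (y + 1)) * (1 - q ^ (d + 1))) * hd

/-- Explicit formula for the `T`-step transition probability of the `q`-exchangeable walk. -/
theorem stmt_1 (q : ℝ) (hq0 : 0 < q) (hq1 : q < 1) (T x y : ℕ) (hT : x ≤ T + y) :
    Ups1T q T (x : ℤ) (y : ℤ)
      = (if y ≤ x then 1 else 0) * (∏ j ∈ Finset.Icc (y + 1) x, (1 - q ^ j)) *
          q ^ (y * (T + y - x)) * qPoch q q T /
          (qPoch q q (x - y) * qPoch q q (T + y - x)) := by
  split_ifs with hxy
  · obtain ⟨d, rfl⟩ := Nat.exists_eq_add_of_le hxy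
    rw [eq_div_iff (mul_ne_zero (qPoch_self_ne_zero hq0 hq1 _) (qPoch_self_ne_zero hq0 hq1 _)),
      one_mul, Nat.add_sub_cancel_left]
    exact Ups1T_add_mul_qPoch q T y d _ (by omega)
  · rw [Ups1T_eq_zero_of_lt q T x y (by omega)]
    simp
end

section
/- Fix q ∈ (0,1), m ≥ 1, and x, y ∈ W_m. For T large enough, the determinant det[Υ₁^{(T)}(x_i, m−j)]_{i,j=1}^m is nonzero, and lim_{T→+∞} det[Υ₁^{(T−1)}(y_i, m−j)]_{i,j=1}^m / det[Υ₁^{(T)}(x_i, m−j)]_{i,j=1}^m = q^{−m(m−1)/2 + (m−1)(|x|−|y|)} ∏_{1≤i<j≤m} (q^{y_j}−q^{y_i})/(q^{x_j}−q^{x_i}). -/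
/-- `W_m = {x₁ > x₂ > … > x_m ≥ 0}` (here `x : Fin m → ℤ` lists the coordinates). -/
def Wm (m : ℕ) (x : Fin m → ℤ) : Prop := StrictAnti x ∧ ∀ i, 0 ≤ x i

/-- The polynomial `∏_{i < l} (X - q⁻ⁱ)` at `q⁻ᵏ`. As a function of `k` it is a right eigenvector of
the transition matrix, with eigenvalue `q ^ l`. -/
noncomputable def eigenvec (q : ℝ) (k l : ℕ) : ℝ :=
  ∏ i ∈ Finset.range l, (q⁻¹ ^ k - q⁻¹ ^ i)

theorem eigenvec_nonneg {q : ℝ} (hq0 : 0 < q) (hq1 : q < 1) (k l : ℕ) : 0 ≤ eigenvec q k l := by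
  have h1 : 1 ≤ q⁻¹ := (one_le_inv₀ hq0).2 hq1.le
  rcases lt_or_ge k l with h | h
  · exact (Finset.prod_eq_zero (Finset.mem_range.2 h) (sub_self _)).ge
  · refine Finset.prod_nonneg fun i hi => sub_nonneg.2 (pow_le_pow_right₀ h1 ?_)
    exact (Finset.mem_range.1 hi).le.trans h

theorem eigenvec_self_pos {q : ℝ} (hq0 : 0 < q) (hq1 : q < 1) (l : ℕ) : 0 < eigenvec q l l :=
  Finset.prod_pos fun _ hi =>
    sub_pos.2 (pow_lt_pow_right₀ ((one_lt_inv₀ hq0).2 hq1) (Finset.mem_range.1 hi))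

theorem eigenvec_recurrence {q : ℝ} (hq0 : 0 < q) (k l : ℕ) :
    (1 - q ^ (k + 1)) * eigenvec q k l = (q ^ l - q ^ (k + 1)) * eigenvec q (k + 1) l := by
  induction l with
  | zero => simp [eigenvec]
  | succ l ih =>
    have h : ∀ n, eigenvec q n (l + 1) = eigenvec q n l * (q⁻¹ ^ n - q⁻¹ ^ l) := fun n =>
      Finset.prod_range_succ _ _
    rw [h, h, ← mul_assoc, ih]
    have : (q ^ l - q ^ (k + 1)) * (q⁻¹ ^ k - q⁻¹ ^ l) =
        (q ^ (l + 1) - q ^ (k + 1)) * (q⁻¹ ^ (k + 1) - q⁻¹ ^ l) := by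
      simp only [inv_pow]
      field_simp
      ring
    linear_combination eigenvec q (k + 1) l * this

theorem Ups1T_succ_natCast (q : ℝ) (T : ℕ) (x : ℤ) (k : ℕ) :
    Ups1T q (T + 1) x k =
      Ups1T q T x k * q ^ k + Ups1T q T x (k + 1 : ℕ) * (1 - q ^ (k + 1)) := by
  rw [Ups1T, tsum_eq_sum (s := {k, k + 1})]
  · rw [Finset.sum_pair (by simp)]
    have h1 : Ups1 q (k : ℤ) k = q ^ k := by simp [Ups1]
    have h2 : Ups1 q ((k + 1 : ℕ) : ℤ) k = 1 - q ^ (k + 1) := by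
      rw [Ups1, if_neg (by omega), if_pos (by omega), zpow_natCast]
    rw [h1, h2]
  · intro z hz
    simp only [Finset.mem_insert, Finset.mem_singleton, not_or] at hz
    rw [Ups1, if_neg (by omega), if_neg (by omega), mul_zero]

theorem Ups1T_natCast_eq_zero (q : ℝ) (T : ℕ) {x k : ℕ} (h : x < k) : Ups1T q T x k = 0 := by
  induction T generalizing k with
  | zero => rw [Ups1T, if_neg (by omega)]
  | succ T ih => rw [Ups1T_succ_natCast, ih h, ih (by omega)]; ring

theorem Ups1T_natCast_nonneg {q : ℝ} (hq0 : 0 < q) (hq1 : q < 1) (T : ℕ) (x : ℤ) (k : ℕ) :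
    0 ≤ Ups1T q T x k := by
  induction T generalizing k with
  | zero => rw [Ups1T]; split_ifs <;> norm_num
  | succ T ih =>
    rw [Ups1T_succ_natCast]
    have h : 0 ≤ 1 - q ^ (k + 1) := sub_nonneg.2 (pow_le_one₀ hq0.le hq1.le)
    have h1 := ih k
    have h2 := ih (k + 1)
    positivity

theorem sum_Ups1T_mul_eigenvec {q : ℝ} (hq0 : 0 < q) (T l : ℕ) {x N : ℕ} (hN : x < N) :
    ∑ k ∈ Finset.range N, Ups1T q T x k * eigenvec q k l = q ^ (l * T) * eigenvec q x l := by
  induction T with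
  | zero =>
    rw [Finset.sum_eq_single_of_mem x (Finset.mem_range.2 hN)]
    · simp [Ups1T]
    · intro k _ hk
      rw [Ups1T, if_neg (by omega), zero_mul]
  | succ T ih =>
    set g : ℕ → ℝ := fun k => Ups1T q T x k * (q ^ l - q ^ k) * eigenvec q k l with hg
    have hg0 : g 0 = 0 := by
      rcases l with _ | l
      · simp [hg]
      · have : eigenvec q 0 (l + 1) = 0 :=
          Finset.prod_eq_zero (Finset.mem_range.2 l.succ_pos) (sub_self _)
        simp [hg, this]
    have hgN : g N = 0 := by simp [hg, Ups1T_natCast_eq_zero q T hN]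
    have hshift : ∑ k ∈ Finset.range N, g (k + 1) = ∑ k ∈ Finset.range N, g k := by
      have h1 := Finset.sum_range_succ g N
      rw [Finset.sum_range_succ', hg0, hgN] at h1
      simpa using h1
    have hstep : ∀ k : ℕ, Ups1T q (T + 1) x k * eigenvec q k l =
        Ups1T q T x k * eigenvec q k l * q ^ k + g (k + 1) := by
      intro k
      rw [Ups1T_succ_natCast]
      linear_combination Ups1T q T x (k + 1 : ℕ) * eigenvec_recurrence hq0 k l
    rw [Finset.sum_congr rfl fun k _ => hstep k, Finset.sum_add_distrib, hshift,
      ← Finset.sum_add_distrib]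
    calc _ = ∑ k ∈ Finset.range N, q ^ l * (Ups1T q T x k * eigenvec q k l) :=
          Finset.sum_congr rfl fun k _ => by simp only [hg]; ring
      _ = _ := by rw [← Finset.mul_sum, ih]; ring

theorem Ups1T_natCast_le {q : ℝ} (hq0 : 0 < q) (hq1 : q < 1) (T x k : ℕ) :
    Ups1T q T x k ≤ q ^ (k * T) * (eigenvec q x k / eigenvec q k k) := by
  rw [← mul_div_assoc, le_div_iff₀ (eigenvec_self_pos hq0 hq1 k),
    ← sum_Ups1T_mul_eigenvec hq0 T k (show x < x + k + 1 by omega)]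
  exact Finset.single_le_sum (f := fun j : ℕ => Ups1T q T x j * eigenvec q j k)
    (fun j _ => mul_nonneg (Ups1T_natCast_nonneg hq0 hq1 T x j) (eigenvec_nonneg hq0 hq1 j k))
    (Finset.mem_range.2 (by omega))

theorem tendsto_inv_pow_mul_Ups1T {q : ℝ} (hq0 : 0 < q) (hq1 : q < 1) (x : ℕ) {k l : ℕ}
    (h : l < k) :
    Filter.Tendsto (fun T : ℕ => q⁻¹ ^ (l * T) * Ups1T q T x k) Filter.atTop (nhds 0) := by
  have hlim : Filter.Tendsto (fun T : ℕ => (q ^ (k - l)) ^ T *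
      (eigenvec q x k / eigenvec q k k)) Filter.atTop (nhds 0) := by
    simpa using (tendsto_pow_atTop_nhds_zero_of_lt_one (by positivity)
      (pow_lt_one₀ hq0.le hq1 (by omega : k - l ≠ 0))).mul_const
        (eigenvec q x k / eigenvec q k k)
  refine squeeze_zero (fun T => mul_nonneg (by positivity)
    (Ups1T_natCast_nonneg hq0 hq1 T x k)) (fun T => ?_) hlim
  refine (mul_le_mul_of_nonneg_left (Ups1T_natCast_le hq0 hq1 T x k)
    (by positivity)).trans_eq ?_
  obtain ⟨d, rfl⟩ := Nat.exists_eq_add_of_lt h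
  rw [← mul_assoc, show l + d + 1 - l = d + 1 by omega, ← pow_mul, add_assoc, add_mul l, pow_add,
    ← mul_assoc, ← mul_pow, inv_mul_cancel₀ hq0.ne', one_pow, one_mul]

theorem tendsto_truncated_sum {q : ℝ} (hq0 : 0 < q) (hq1 : q < 1) (x : ℕ) {l m : ℕ}
    (h : l < m) :
    Filter.Tendsto (fun T : ℕ => q⁻¹ ^ (l * T) *
      ∑ k ∈ Finset.range m, Ups1T q T x k * eigenvec q k l) Filter.atTop
      (nhds (eigenvec q x l)) := by
  have htail : Filter.Tendsto (fun T : ℕ => eigenvec q x l -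
      ∑ k ∈ Finset.Ico m (m + x + 1), q⁻¹ ^ (l * T) * Ups1T q T x k * eigenvec q k l)
      Filter.atTop (nhds (eigenvec q x l - ∑ k ∈ Finset.Ico m (m + x + 1), 0 * eigenvec q k l)) :=
    tendsto_const_nhds.sub <| tendsto_finsetSum _ fun k hk =>
      (tendsto_inv_pow_mul_Ups1T hq0 hq1 x
        (h.trans_le (Finset.mem_Ico.1 hk).1)).mul_const _
  simp only [zero_mul, Finset.sum_const_zero, sub_zero] at htail
  refine htail.congr fun T => ?_
  have hsum := sum_Ups1T_mul_eigenvec hq0 T l (show x < m + x + 1 by omega)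
  rw [← Finset.sum_range_add_sum_Ico _ (show m ≤ m + x + 1 by omega)] at hsum
  have hone : q⁻¹ ^ (l * T) * q ^ (l * T) = 1 := by
    rw [← mul_pow, inv_mul_cancel₀ hq0.ne', one_pow]
  simp only [mul_assoc, ← Finset.mul_sum]
  linear_combination q⁻¹ ^ (l * T) * (-hsum) - eigenvec q x l * hone

theorem det_eigenvec (q : ℝ) {m : ℕ} (z : Fin m → ℕ) :
    Matrix.det (Matrix.of fun i l : Fin m => eigenvec q (z i) l) =
      (Matrix.vandermonde fun i => q⁻¹ ^ z i).det := by
  rw [Matrix.det_eval_matrixOfPolynomials_eq_det_vandermonde (fun i => q⁻¹ ^ z i)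
    (fun l => ∏ i ∈ Finset.range l, (Polynomial.X - Polynomial.C (q⁻¹ ^ i)))]
  · congr 1
    ext i l
    simp [eigenvec, Polynomial.eval_prod]
  · intro l
    simp
  · intro l
    exact Polynomial.monic_prod_X_sub_C _ _

theorem det_vandermonde_inv_pow_ne_zero {q : ℝ} (hq0 : 0 < q) (hq1 : q < 1) {m : ℕ}
    {z : Fin m → ℕ} (hz : Function.Injective z) :
    (Matrix.vandermonde fun i => q⁻¹ ^ z i).det ≠ 0 :=
  Matrix.det_vandermonde_ne_zero_iff.2
    ((pow_right_injective₀ (inv_pos.2 hq0) (one_lt_inv₀ hq0 |>.2 hq1).ne').comp hz)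

theorem tendsto_normalized_det {q : ℝ} (hq0 : 0 < q) (hq1 : q < 1) {m : ℕ} (x : Fin m → ℕ) :
    Filter.Tendsto (fun T : ℕ =>
      Matrix.det (Matrix.of fun i j : Fin m => Ups1T q T (x i) ((m : ℤ) - 1 - (j : ℕ))) *
        (Matrix.vandermonde fun j : Fin m => q⁻¹ ^ (j.rev : ℕ)).det *
        q⁻¹ ^ ((∑ l : Fin m, (l : ℕ)) * T)) Filter.atTop
      (nhds (Matrix.vandermonde fun i => q⁻¹ ^ x i).det) := by
  rw [← det_eigenvec q x, ← det_eigenvec q fun j : Fin m => (j.rev : ℕ)]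
  have hmat : Filter.Tendsto (fun T : ℕ => (Matrix.of fun i l : Fin m => q⁻¹ ^ ((l : ℕ) * T) *
      ∑ k ∈ Finset.range m, Ups1T q T (x i) k * eigenvec q k l)) Filter.atTop
      (nhds (Matrix.of fun i l : Fin m => eigenvec q (x i) l)) :=
    tendsto_pi_nhds.2 fun i => tendsto_pi_nhds.2 fun l =>
      tendsto_truncated_sum hq0 hq1 (x i) l.isLt
  refine (((continuous_id.matrix_det).tendsto _).comp hmat).congr fun T => ?_
  have hdiag : q⁻¹ ^ ((∑ l : Fin m, (l : ℕ)) * T) =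
      (Matrix.diagonal fun l : Fin m => q⁻¹ ^ ((l : ℕ) * T)).det := by
    rw [Matrix.det_diagonal, Finset.sum_mul, Finset.prod_pow_eq_pow_sum]
  rw [hdiag, ← Matrix.det_mul, ← Matrix.det_mul, Function.comp_apply, id]
  congr 1
  ext i l
  rw [Matrix.mul_diagonal, Matrix.mul_apply, Matrix.of_apply, mul_comm, Finset.sum_range,
    ← Equiv.sum_comp Fin.revPerm]
  congr 1
  refine Finset.sum_congr rfl fun j _ => ?_
  have : (((j.rev : Fin m) : ℕ) : ℤ) = (m : ℤ) - 1 - (j : ℕ) := by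
    rw [Fin.val_rev]; omega
  rw [Fin.revPerm_apply, this, Matrix.of_apply, Matrix.of_apply]

theorem det_vandermonde_inv_pow {q : ℝ} (hq0 : 0 < q) {m : ℕ} (x : Fin m → ℕ) :
    (Matrix.vandermonde fun i => q⁻¹ ^ x i).det =
      (-1) ^ (∑ i : Fin m, (Finset.Ioi i).card) * q⁻¹ ^ ((m - 1) * ∑ i, x i) *
        ∏ i : Fin m, ∏ j ∈ Finset.Ioi i, (q ^ x j - q ^ x i) := by
  have hfac : ∀ i j, q⁻¹ ^ x j - q⁻¹ ^ x i =
      (-1) * (q⁻¹ ^ x i * q⁻¹ ^ x j) * (q ^ x j - q ^ x i) := by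
    intro i j
    simp only [inv_pow]
    field_simp
    ring
  rw [Matrix.det_vandermonde]
  simp only [hfac, Finset.prod_mul_distrib, Finset.prod_const]
  rw [Finset.prod_pow_eq_pow_sum]
  congr 2
  simp only [← Finset.prod_const, ← Finset.prod_mul_distrib]
  rw [Finset.prod_prod_Ioi_mul_eq_prod_prod_off_diag (fun _ i => q⁻¹ ^ x i)]
  simp [Finset.card_compl, ← pow_mul, Finset.prod_pow_eq_pow_sum, ← Finset.sum_mul, mul_comm]

/-- For large `T` the Karlin–McGregor determinant is nonzero, and the ratio of
determinants converges to the `h`-transform factor of the noncolliding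
`q`-exchangeable walks. -/
theorem stmt_2 (q : ℝ) (hq0 : 0 < q) (hq1 : q < 1) (m : ℕ) (hm : 1 ≤ m)
    (x y : Fin m → ℤ) (hx : Wm m x) (hy : Wm m y) :
    (∀ᶠ T : ℕ in Filter.atTop,
        Matrix.det (Matrix.of fun i j : Fin m => Ups1T q T (x i) ((m : ℤ) - 1 - (j : ℕ))) ≠ 0) ∧
    Filter.Tendsto
      (fun T : ℕ =>
        Matrix.det (Matrix.of fun i j : Fin m => Ups1T q (T - 1) (y i) ((m : ℤ) - 1 - (j : ℕ))) /
          Matrix.det (Matrix.of fun i j : Fin m => Ups1T q T (x i) ((m : ℤ) - 1 - (j : ℕ))))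
      Filter.atTop
      (nhds (q ^ (-((m : ℤ) * ((m : ℤ) - 1) / 2) + ((m : ℤ) - 1) * ((∑ i, x i) - ∑ i, y i)) *
        ∏ i : Fin m, ∏ j ∈ Finset.Ioi i, (q ^ (y j) - q ^ (y i)) / (q ^ (x j) - q ^ (x i)))) := by
  lift x to Fin m → ℕ using hx.2
  lift y to Fin m → ℕ using hy.2
  have hxinj : Function.Injective x := fun i j h => hx.1.injective (congrArg Nat.cast h)
  set κ := (Matrix.vandermonde fun j : Fin m => q⁻¹ ^ (j.rev : ℕ)).det with hκdef
  have hκ : κ ≠ 0 := det_vandermonde_inv_pow_ne_zero hq0 hq1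
    (Fin.val_injective.comp Fin.rev_injective)
  have hVx := det_vandermonde_inv_pow_ne_zero hq0 hq1 hxinj
  have hlimx := tendsto_normalized_det hq0 hq1 x
  have hlimy := (tendsto_normalized_det hq0 hq1 y).comp (Filter.tendsto_sub_atTop_nat 1)
  have hne := hlimx.eventually_ne hVx
  refine ⟨hne.mono fun T hT h => hT (by rw [h, zero_mul, zero_mul]), ?_⟩
  set N := ∑ l : Fin m, (l : ℕ) with hN
  have hlim := (hlimy.div hlimx hVx).const_mul (q⁻¹ ^ N)
  have hexp : (m : ℤ) * ((m : ℤ) - 1) / 2 = N := by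
    have h := Finset.sum_range_id_mul_two m
    rw [Finset.sum_range, ← hN] at h
    have h2 : (m : ℤ) * ((m : ℤ) - 1) = N * 2 := by
      rw [← Nat.cast_one, ← Nat.cast_sub hm]
      exact_mod_cast h.symm
    omega
  have hval : q⁻¹ ^ N * ((Matrix.vandermonde fun i => q⁻¹ ^ y i).det /
      (Matrix.vandermonde fun i => q⁻¹ ^ x i).det) =
      q ^ (-((m : ℤ) * ((m : ℤ) - 1) / 2) +
        ((m : ℤ) - 1) * ((∑ i, (x i : ℤ)) - ∑ i, (y i : ℤ))) *
      ∏ i : Fin m, ∏ j ∈ Finset.Ioi i,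
        (q ^ (y j : ℤ) - q ^ (y i : ℤ)) / (q ^ (x j : ℤ) - q ^ (x i : ℤ)) := by
    rw [det_vandermonde_inv_pow hq0] at hVx
    rw [det_vandermonde_inv_pow hq0, det_vandermonde_inv_pow hq0, hexp, mul_sub, zpow_add₀ hq0.ne',
      zpow_sub₀ hq0.ne', zpow_neg, zpow_natCast, ← Nat.cast_sum, ← Nat.cast_sum,
      show (m : ℤ) - 1 = ((m - 1 : ℕ) : ℤ) by rw [Nat.cast_sub hm, Nat.cast_one],
      ← Nat.cast_mul, ← Nat.cast_mul]
    simp only [zpow_natCast, Finset.prod_div_distrib]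
    have hP := right_ne_zero_of_mul hVx
    have hs : ((-1 : ℝ) ^ (∑ i : Fin m, (Finset.Ioi i).card)) ≠ 0 := by simp
    generalize (-1 : ℝ) ^ (∑ i : Fin m, (Finset.Ioi i).card) = s at hs
    simp only [inv_pow]
    field_simp
  rw [hval] at hlim
  refine hlim.congr' ?_
  filter_upwards [Filter.eventually_ge_atTop 1] with T hT
  obtain ⟨S, rfl⟩ := Nat.exists_eq_add_of_le' hT
  have hq : q⁻¹ ≠ 0 := inv_ne_zero hq0.ne'
  simp only [Pi.div_apply, Function.comp_apply, Nat.add_sub_cancel, mul_add, mul_one, pow_add]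
  rw [← hκdef, ← mul_div_assoc]
  set r := q⁻¹
  refine Eq.trans ?_ (mul_div_mul_right _ _ (mul_ne_zero hκ
    (mul_ne_zero (pow_ne_zero (N * S) hq) (pow_ne_zero N hq))))
  congr 1 <;> ring
end

section
/- Fix q ∈ (0,1), m ≥ 1, and integers x_1, …, x_m ≥ 0. Then det[ q^{−x_i(j−1)} (q^{x_i−j+2};q)_{j−1} / (q;q)_{j−1} ]_{i,j=1}^{m} = (−1)^{m(m−1)/2} q^{−(m−1)(x_1+…+x_m)} ∏_{1≤i<j≤m}(q^{x_j}−q^{x_i}) / ∏_{k=1}^{m−1}(q;q)_k. -/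
/-- `(q^s;q)_k = ∏_{i=0}^{k−1}(1 − q^{s+i})` for an arbitrary integer `s`. -/
noncomputable def qPochInt (q : ℝ) (s : ℤ) (k : ℕ) : ℝ :=
  ∏ i ∈ Finset.range k, (1 - q ^ (s + i))

open Matrix Polynomial in
/-- The determinant of a Vandermonde matrix at inverses, with the denominators cleared. -/
theorem det_vandermonde_inv {K : Type*} [Field K] {m : ℕ} (w : Fin m → K) (hw : ∀ i, w i ≠ 0) :
    (vandermonde fun i => (w i)⁻¹).det =
      (∏ i, (w i ^ (m - 1))⁻¹) * ∏ i : Fin m, ∏ j ∈ Finset.Ioi i, (w i - w j) := by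
  have h := det_projVandermonde (fun _ => (1 : K)) w
  simp only [one_mul] at h
  rw [← h, ← det_mul_column]
  congr 1
  ext i j
  have hj : m - 1 = (j : ℕ) + (j.rev : ℕ) := by
    rw [Fin.val_rev]
    lia
  simp only [vandermonde_apply, projVandermonde_apply, of_apply, one_pow, one_mul, hj, pow_add,
    inv_pow]
  field_simp [hw i]

theorem prod_Ioi_sub_swap {R : Type*} [CommRing R] {m : ℕ} (w : Fin m → R) :
    ∏ i : Fin m, ∏ j ∈ Finset.Ioi i, (w i - w j) =
      (-1) ^ (m * (m - 1) / 2) * ∏ i : Fin m, ∏ j ∈ Finset.Ioi i, (w j - w i) := by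
  have hcard : ∑ i : Fin m, (Finset.Ioi i).card = m * (m - 1) / 2 := by
    simp only [Fin.card_Ioi]
    rw [Fin.sum_univ_eq_sum_range (fun i => m - 1 - i) m, Finset.sum_range_reflect (fun i => i) m,
      Finset.sum_range_id]
  rw [← hcard, ← Finset.prod_pow_eq_pow_sum, ← Finset.prod_mul_distrib]
  refine Finset.prod_congr rfl fun i _ => ?_
  rw [← Finset.prod_const, ← Finset.prod_mul_distrib]
  exact Finset.prod_congr rfl fun j _ => by ring

/-- `q^{-xk} (q^{x-k+1};q)_k` is a monic polynomial of degree `k` evaluated at `q^{-x}`. -/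
theorem zpow_mul_qPochInt {q : ℝ} (hq : q ≠ 0) (x k : ℕ) :
    q ^ (-((x : ℤ) * k)) * qPochInt q ((x : ℤ) - k + 1) k =
      ∏ l ∈ Finset.range k, ((q ^ (x : ℤ))⁻¹ - q ^ (1 - (k : ℤ) + l)) := by
  have h : q ^ (-((x : ℤ) * k)) = ∏ _l ∈ Finset.range k, (q ^ (x : ℤ))⁻¹ := by
    rw [Finset.prod_const, Finset.card_range, zpow_neg, zpow_mul, zpow_natCast, inv_pow]
  rw [h, qPochInt, ← Finset.prod_mul_distrib]
  refine Finset.prod_congr rfl fun l _ => ?_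
  rw [show (x : ℤ) - k + 1 + l = x + (1 - k + l) by ring, zpow_add₀ hq]
  field_simp [zpow_ne_zero (x : ℤ) hq]

open Matrix Polynomial in
/-- Monic polynomials of degrees `0, …, m - 1` give a Vandermonde determinant. -/
theorem det_prod_sub_eq_det_vandermonde {R : Type*} [CommRing R] [Nontrivial R] {m : ℕ}
    (y : Fin m → R) (c : ℕ → ℕ → R) :
    (of fun i j : Fin m => ∏ l ∈ Finset.range (j : ℕ), (y i - c j l)).det =
      (vandermonde y).det := by
  rw [det_eval_matrixOfPolynomials_eq_det_vandermonde y
    (fun j => ∏ l ∈ Finset.range (j : ℕ), (X - C (c j l)))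
    (fun j => by simp [natDegree_prod_of_monic _ _ fun l _ => monic_X_sub_C (c j l)])
    (fun j => monic_prod_of_monic _ _ fun l _ => monic_X_sub_C _)]
  congr 1
  ext i j
  simp [eval_prod]

/-- The determinant evaluation used in the proof of the never-collide limit:
`det[q^{−x_i(j−1)} (q^{x_i−j+2};q)_{j−1}/(q;q)_{j−1}]
  = (−1)^{m(m−1)/2} q^{−(m−1)|x|} ∏_{i<j}(q^{x_j}−q^{x_i}) / ∏_{k=1}^{m−1}(q;q)_k`. -/
theorem stmt_3 (q : ℝ) (hq0 : 0 < q) (hq1 : q < 1) (m : ℕ) (hm : 1 ≤ m)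
    (x : Fin m → ℕ) :
    Matrix.det (Matrix.of fun i j : Fin m =>
        q ^ (-((x i : ℤ) * (j : ℕ))) * qPochInt q ((x i : ℤ) - (j : ℕ) + 1) (j : ℕ) /
          qPoch q q (j : ℕ))
      = (-1 : ℝ) ^ (m * (m - 1) / 2) * q ^ (-(((m : ℤ) - 1) * ∑ i, (x i : ℤ))) *
          (∏ i : Fin m, ∏ j ∈ Finset.Ioi i, (q ^ (x j : ℤ) - q ^ (x i : ℤ))) /
          ∏ k ∈ Finset.Icc 1 (m - 1), qPoch q q k := by
  have hw : ∀ i, q ^ (x i : ℤ) ≠ 0 := fun i => zpow_ne_zero _ hq0.ne'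
  have hden : ∏ k ∈ Finset.Icc 1 (m - 1), qPoch q q k = ∏ j : Fin m, qPoch q q (j : ℕ) := by
    obtain ⟨n, rfl⟩ := Nat.exists_eq_add_of_le' hm
    rw [Fin.prod_univ_eq_prod_range (qPoch q q), Finset.prod_range_succ', Nat.add_sub_cancel,
      ← Finset.Ico_add_one_right_eq_Icc, Finset.prod_Ico_eq_prod_range]
    simp [qPoch, add_comm]
  have hpow : q ^ (-(((m : ℤ) - 1) * ∑ i, (x i : ℤ))) =
      ∏ i, ((q ^ (x i : ℤ)) ^ (m - 1))⁻¹ := by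
    rw [Finset.prod_inv_distrib, zpow_neg, Finset.prod_pow, mul_comm, zpow_mul,
      ← Nat.cast_one, ← Nat.cast_sub hm, zpow_natCast, ← Nat.cast_sum, zpow_natCast,
      ← Finset.prod_pow_eq_pow_sum]
    simp only [zpow_natCast]
  have hmat : (Matrix.of fun i j : Fin m =>
        q ^ (-((x i : ℤ) * (j : ℕ))) * qPochInt q ((x i : ℤ) - (j : ℕ) + 1) (j : ℕ) /
          qPoch q q (j : ℕ)) =
      Matrix.of fun i j : Fin m => (qPoch q q (j : ℕ))⁻¹ *
        Matrix.of (fun i j : Fin m => ∏ l ∈ Finset.range (j : ℕ),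
          ((q ^ (x i : ℤ))⁻¹ - q ^ (1 - ((j : ℕ) : ℤ) + l))) i j := by
    ext i j
    simp only [Matrix.of_apply]
    rw [zpow_mul_qPochInt hq0.ne', div_eq_inv_mul]
  rw [hmat, Matrix.det_mul_row,
    det_prod_sub_eq_det_vandermonde (fun i => (q ^ (x i : ℤ))⁻¹)
      (fun j l => q ^ (1 - (j : ℤ) + l)),
    det_vandermonde_inv _ hw, prod_Ioi_sub_swap, hden, hpow, Finset.prod_inv_distrib]
  ring
end

section
/- Fix q ∈ (0,1), m ≥ 1, and x ∈ W_m. Then Σ_y h_m(y) Υ_{m,ind}(x,y) = q^{m(m−1)/2} h_m(x), where the (finite) sum is over all y ∈ ℤ^m with y_i ∈ {x_i − 1, x_i} for every i = 1, …, m. That is, h_m is a nonnegative eigenfunction of the transition matrix of m independent q-exchangeable walks, with eigenvalue q^{m(m−1)/2}. -/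
/-- The `q`-deformed Vandermonde `h_m(x) = q^{−(m−1)|x|} ∏_{i<j}(q^{x_j}−q^{x_i})`. -/
noncomputable def hFun (q : ℝ) (m : ℕ) (x : Fin m → ℤ) : ℝ :=
  q ^ (-(((m : ℤ) - 1) * ∑ i, x i)) *
    ∏ i : Fin m, ∏ j ∈ Finset.Ioi i, (q ^ (x j) - q ^ (x i))

/-- Transition matrix of `m` independent `q`-exchangeable walks:
`Υ_{m,ind}(x,y) = ∏ᵢ (q^{xᵢ} 1_{yᵢ=xᵢ} + (1−q^{xᵢ}) 1_{yᵢ=xᵢ−1})`. -/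
noncomputable def UpsInd (q : ℝ) (m : ℕ) (x y : Fin m → ℤ) : ℝ :=
  ∏ i : Fin m, (q ^ (x i) * (if y i = x i then 1 else 0)
    + (1 - q ^ (x i)) * (if y i = x i - 1 then 1 else 0))

/-- `h_m` is nonnegative on strictly decreasing configurations. -/
theorem hFun_nonneg {q : ℝ} (hq0 : 0 < q) (hq1 : q < 1) {m : ℕ} {x : Fin m → ℤ}
    (hx : StrictAnti x) : 0 ≤ hFun q m x := by
  refine mul_nonneg (zpow_nonneg hq0.le _)
    (Finset.prod_nonneg fun i _ => Finset.prod_nonneg fun j hj => sub_nonneg.2 ?_)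
  exact zpow_le_zpow_right_of_le_one₀ hq0 hq1.le (hx (Finset.mem_Ioi.1 hj)).le

/-- The matrix with entries `q^{(j−(m−1)) x_i}`, whose determinant is `h_m(x)`. -/
noncomputable def weightedPowers (q : ℝ) (m : ℕ) (x : Fin m → ℤ) : Matrix (Fin m) (Fin m) ℝ :=
  Matrix.of fun i j => q ^ (-(((m : ℤ) - 1) * x i)) * (q ^ x i) ^ (j : ℕ)

/-- A finite product of integer powers of `q ≠ 0`. -/
theorem zpow_sum_of_ne_zero {ι K : Type*} [Field K] {q : K} (hq : q ≠ 0) (s : Finset ι)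
    (f : ι → ℤ) : q ^ ∑ i ∈ s, f i = ∏ i ∈ s, q ^ f i := by
  classical
  induction s using Finset.induction_on with
  | empty => simp
  | insert a s ha ih => rw [Finset.sum_insert ha, Finset.prod_insert ha, zpow_add₀ hq, ih]

theorem hFun_eq_det {q : ℝ} (hq : q ≠ 0) (m : ℕ) (x : Fin m → ℤ) :
    hFun q m x = (weightedPowers q m x).det := by
  have h := Matrix.det_mul_column (fun i => q ^ (-(((m : ℤ) - 1) * x i)))
    (Matrix.vandermonde fun i => q ^ x i)
  rw [Matrix.det_vandermonde, ← zpow_sum_of_ne_zero hq, Finset.sum_neg_distrib,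
    ← Finset.mul_sum] at h
  exact h.symm

theorem UpsInd_sub_indicator (q : ℝ) (m : ℕ) (x : Fin m → ℤ) (S : Finset (Fin m)) :
    UpsInd q m x (fun i => x i - if i ∈ S then 1 else 0)
      = ∏ i, if i ∈ S then 1 - q ^ x i else q ^ x i := by
  refine Finset.prod_congr rfl fun i _ => ?_
  by_cases h : i ∈ S
  · simp [h]
  · simp [h, (sub_one_lt (x i)).ne']

/-- The lower triangular matrix through which one step of a walk acts on the functions
`q^{(j−(m−1)) x}`. -/
noncomputable def stepMatrix (q : ℝ) (m : ℕ) : Matrix (Fin m) (Fin m) ℝ :=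
  Matrix.of fun l j => (if l = j then q ^ (j.rev : ℕ) else 0)
    + if (l : ℕ) = j + 1 then 1 - q ^ (j.rev : ℕ) else 0

theorem det_stepMatrix (q : ℝ) (m : ℕ) : (stepMatrix q m).det = q ^ (m * (m - 1) / 2) := by
  rw [Matrix.det_of_isLowerTriangular]
  · have h : ∀ i : Fin m, stepMatrix q m i i = q ^ (i.rev : ℕ) := fun i => by simp [stepMatrix]
    simp_rw [h]
    rw [Finset.prod_pow_eq_pow_sum, ← Finset.sum_range_id,
      ← Fin.sum_univ_eq_sum_range (fun i => i)]
    congr 1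
    exact Equiv.sum_comp Fin.revPerm (fun i : Fin m => (i : ℕ))
  · intro i j hij
    have hij : i < j := hij
    have h : (i : ℕ) ≠ j + 1 := by have := Fin.lt_def.1 hij; omega
    simp [stepMatrix, hij.ne, h]

/-- One step of a single walk, applied to the rows of `weightedPowers`. -/
theorem weightedPowers_mul_stepMatrix {q : ℝ} (hq : q ≠ 0) (m : ℕ) (x : Fin m → ℤ) :
    weightedPowers q m x * stepMatrix q m
      = (fun i j => (1 - q ^ x i) * weightedPowers q m (fun k => x k - 1) i j)
        + fun i j => q ^ x i * weightedPowers q m x i j := by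
  ext i j
  have hshift : weightedPowers q m (fun k => x k - 1) i j
      = q ^ (j.rev : ℕ) * weightedPowers q m x i j := by
    simp only [weightedPowers, Matrix.of_apply, ← zpow_natCast, ← zpow_mul, ← zpow_add₀ hq]
    congr 1
    have : ((j.rev : ℕ) : ℤ) = m - 1 - j := by
      rw [Fin.val_rev]
      have := j.isLt
      omega
    rw [this]
    ring
  have hsum : ∑ l : Fin m, weightedPowers q m x i l *
      (if (l : ℕ) = j + 1 then 1 - q ^ (j.rev : ℕ) else 0)
        = q ^ x i * weightedPowers q m x i j * (1 - q ^ (j.rev : ℕ)) := by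
    by_cases hj : (j : ℕ) + 1 < m
    · rw [Finset.sum_eq_single ⟨j + 1, hj⟩]
      · simp only [if_true, weightedPowers, Matrix.of_apply, pow_succ]
        ring
      · intro l _ hl
        rw [if_neg fun h => hl (Fin.ext h), mul_zero]
      · simp
    · have h0 : (j.rev : ℕ) = 0 := by rw [Fin.val_rev]; omega
      simp only [h0, pow_zero, sub_self, ite_self, mul_zero, Finset.sum_const_zero]
  rw [Matrix.mul_apply]
  change _ = (1 - q ^ x i) * weightedPowers q m (fun k => x k - 1) i j
    + q ^ x i * weightedPowers q m x i j
  rw [hshift]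
  simp only [stepMatrix, Matrix.of_apply, mul_add, Finset.sum_add_distrib, hsum]
  simp only [mul_ite, mul_zero, Finset.sum_ite_eq', Finset.mem_univ, if_true]
  ring

/-- `h_m` is a nonnegative eigenfunction of `Υ_{m,ind}` with eigenvalue `q^{m(m−1)/2}`;
the sum over all `y` with `yᵢ ∈ {xᵢ−1, xᵢ}` is enumerated by subsets `S ⊆ {1,…,m}`
of coordinates which move down. -/
theorem stmt_4 (q : ℝ) (hq0 : 0 < q) (hq1 : q < 1) (m : ℕ) (hm : 1 ≤ m)
    (x : Fin m → ℤ) (hx : Wm m x) :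
    0 ≤ hFun q m x ∧
    ∑ S : Finset (Fin m),
        hFun q m (fun i => x i - if i ∈ S then 1 else 0) *
          UpsInd q m x (fun i => x i - if i ∈ S then 1 else 0)
      = q ^ (m * (m - 1) / 2) * hFun q m x := by
  refine ⟨hFun_nonneg hq0 hq1 hx.1, ?_⟩
  simp_rw [mul_comm (hFun _ _ _), hFun_eq_det hq0.ne', UpsInd_sub_indicator]
  simp_rw [← Matrix.det_mul_column]
  rw [mul_comm, ← det_stepMatrix, ← Matrix.det_mul, weightedPowers_mul_stepMatrix hq0.ne']
  refine Eq.trans ?_ (MultilinearMap.map_add_univ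
    (Matrix.detRowAlternating (n := Fin m) (R := ℝ)).toMultilinearMap _ _).symm
  refine Finset.sum_congr rfl fun S _ => ?_
  change Matrix.det _ = Matrix.det _
  congr 1
  ext i j
  by_cases h : i ∈ S <;> simp [h, weightedPowers]
end

section
/- Fix q ∈ (0,1), integers t₁ ≥ 0, t₂ ≥ 1, p₁, p₂ ∈ ℤ, and an integer N ≥ t₁ + t₂ + 2. Let Φ_N(w) = Σ_{j=0}^{N−t₁−1} [(q^{N−t₁−1};q^{−1})_j / (q^{N−1};q^{−1})_j] q^{j p₁} w^{−j}, and G_N(w) = (q^{N−1};q^{−1})_{t₁} · w^{N−t₂} · q^{p₂ t₂ − N p₁} · Φ_N(w) · (w q^{1−p₂};q)_{t₂−1} / (q;q)_{t₂−1}. Then for every r > 0, (1/(2πi)) ∮_{|w|=r} G_N(w) dw/w = 1_{t₂ > t₁} · q^{−t₂(p₁−p₂)} · (q^{p₁−p₂+1};q)_{t₂−t₁−1} / (q;q)_{t₂−t₁−1}, where the circle |w| = r is traversed counterclockwise. -/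
/-- `(a;q)_k = ∏_{i=0}^{k−1}(1 − a q^i)` for complex `a, q`. -/
noncomputable def qPochC (q a : ℂ) (k : ℕ) : ℂ := ∏ i ∈ Finset.range k, (1 - a * q ^ i)

/-- `(q^s;q)_k = ∏_{i=0}^{k−1}(1 − q^{s+i})` for an arbitrary integer `s`. -/
noncomputable def qPochCInt (q : ℂ) (s : ℤ) (k : ℕ) : ℂ :=
  ∏ i ∈ Finset.range k, (1 - q ^ (s + i))

/-- `(q^s;q^{−1})_k = ∏_{i=0}^{k−1}(1 − q^{s−i})` for an arbitrary integer `s`. -/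
noncomputable def qPochCIntInv (q : ℂ) (s : ℤ) (k : ℕ) : ℂ :=
  ∏ i ∈ Finset.range k, (1 - q ^ (s - i))

/-- `Φ_N(w) = Σ_{j=0}^{N−t₁−1} [(q^{N−t₁−1};q^{−1})_j / (q^{N−1};q^{−1})_j] q^{j p₁} w^{−j}`. -/
noncomputable def PhiN (q : ℂ) (N t₁ : ℕ) (p₁ : ℤ) (w : ℂ) : ℂ :=
  ∑ j ∈ Finset.range (N - t₁),
    (qPochCIntInv q ((N : ℤ) - t₁ - 1) j / qPochCIntInv q ((N : ℤ) - 1) j) *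
      q ^ ((j : ℤ) * p₁) * w ^ (-(j : ℤ))

/-- `G_N(w) = (q^{N−1};q^{−1})_{t₁} w^{N−t₂} q^{p₂t₂−Np₁} Φ_N(w) (wq^{1−p₂};q)_{t₂−1}/(q;q)_{t₂−1}`. -/
noncomputable def GN (q : ℂ) (N t₁ t₂ : ℕ) (p₁ p₂ : ℤ) (w : ℂ) : ℂ :=
  qPochCIntInv q ((N : ℤ) - 1) t₁ * w ^ ((N : ℤ) - t₂) * q ^ (p₂ * t₂ - N * p₁) *
    PhiN q N t₁ p₁ w * qPochC q (w * q ^ (1 - p₂)) (t₂ - 1) / qPochC q q (t₂ - 1)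

/-- Coefficients of `(z;q)_n` as a polynomial in `z`: the signed `q`-binomial coefficients,
given by their Pascal recurrence. -/
noncomputable def qPochCoeff (q : ℂ) : ℕ → ℕ → ℂ
  | 0, 0 => 1
  | 0, _ + 1 => 0
  | _ + 1, 0 => 1
  | n + 1, k + 1 => qPochCoeff q n (k + 1) - q ^ n * qPochCoeff q n k

theorem qPochCoeff_zero_right (q : ℂ) (n : ℕ) : qPochCoeff q n 0 = 1 := by
  cases n <;> rfl

theorem qPochCoeff_succ_succ (q : ℂ) (n k : ℕ) :
    qPochCoeff q (n + 1) (k + 1) = qPochCoeff q n (k + 1) - q ^ n * qPochCoeff q n k := rfl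

theorem qPochCoeff_eq_zero_of_lt (q : ℂ) {n k : ℕ} (h : n < k) : qPochCoeff q n k = 0 := by
  induction n generalizing k with
  | zero =>
    obtain ⟨k, rfl⟩ := Nat.exists_eq_succ_of_ne_zero h.ne'
    rfl
  | succ n ih =>
    obtain ⟨k, rfl⟩ := Nat.exists_eq_succ_of_ne_zero (by omega : k ≠ 0)
    rw [Nat.succ_eq_add_one, qPochCoeff_succ_succ, ih (by omega), ih (by omega)]
    simp

theorem qPochC_succ (q a : ℂ) (n : ℕ) :
    qPochC q a (n + 1) = qPochC q a n * (1 - a * q ^ n) :=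
  Finset.prod_range_succ _ _

/-- The finite `q`-binomial theorem. -/
theorem qPochC_eq_sum (q z : ℂ) (n : ℕ) :
    qPochC q z n = ∑ k ∈ Finset.range (n + 1), qPochCoeff q n k * z ^ k := by
  induction n with
  | zero => simp [qPochC, qPochCoeff_zero_right]
  | succ n ih =>
    rw [Finset.sum_range_succ', qPochC_succ, mul_sub, mul_one]
    simp only [qPochCoeff_succ_succ, sub_mul, Finset.sum_sub_distrib]
    have h : ∑ k ∈ Finset.range (n + 1), qPochCoeff q n (k + 1) * z ^ (k + 1) + 1
        = qPochC q z n := by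
      rw [Finset.sum_range_succ, qPochCoeff_eq_zero_of_lt q n.lt_succ_self, ih,
        Finset.sum_range_succ' _ n]
      simp [qPochCoeff_zero_right]
    have h' : ∑ k ∈ Finset.range (n + 1), q ^ n * qPochCoeff q n k * z ^ (k + 1)
        = qPochC q z n * (z * q ^ n) := by
      rw [ih, Finset.sum_mul]
      exact Finset.sum_congr rfl fun k _ => by ring
    rw [h', ← h, qPochCoeff_zero_right]
    ring

/-- Closed form of the coefficients, with denominators cleared. -/
theorem qPochCoeff_mul_mul (q : ℂ) (k l : ℕ) :
    qPochCoeff q (k + l) k * qPochC q q k * qPochC q q l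
      = (-1) ^ k * q ^ k.choose 2 * qPochC q q (k + l) := by
  induction h : k + l generalizing k l with
  | zero =>
    obtain ⟨rfl, rfl⟩ : k = 0 ∧ l = 0 := by omega
    simp [qPochCoeff_zero_right, qPochC]
  | succ n ih =>
    rcases k with _ | k
    · obtain rfl : l = n + 1 := by omega
      simp [qPochCoeff_zero_right, qPochC]
    have hk : (k + 1).choose 2 = k + k.choose 2 := by
      rw [Nat.choose_succ_succ' k 1, Nat.choose_one_right]
    rw [qPochCoeff_succ_succ, hk]
    rcases l with _ | l
    · obtain rfl : k = n := by omega
      have e := ih k 0 rfl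
      rw [qPochCoeff_eq_zero_of_lt q k.lt_succ_self, qPochC_succ]
      simp only [pow_add, pow_succ] at e ⊢
      linear_combination (-q ^ k * (1 - q * q ^ k)) * e
    · obtain rfl : n = k + l + 1 := by omega
      have e₁ := ih (k + 1) l (by omega)
      have e₂ := ih k (l + 1) (by omega)
      rw [hk] at e₁
      rw [qPochC_succ q q (k + l + 1), qPochC_succ q q l]
      rw [qPochC_succ q q l] at e₂
      rw [qPochC_succ q q k] at e₁ ⊢
      simp only [pow_add, pow_succ] at e₁ e₂ ⊢
      linear_combination (1 - q * q ^ l) * e₁ - (q ^ k * q ^ l * q) * (1 - q * q ^ k) * e₂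

theorem qPochC_self_ne_zero {q : ℝ} (hq0 : 0 < q) (hq1 : q < 1) (n : ℕ) :
    qPochC (q : ℂ) q n ≠ 0 := by
  refine Finset.prod_ne_zero_iff.2 fun i _ => ?_
  have h : q * q ^ i < 1 := by
    rw [← pow_succ']
    exact pow_lt_one₀ hq0.le hq1 i.succ_ne_zero
  exact_mod_cast (sub_pos.2 h).ne'

theorem qPochCIntInv_mul_qPochC {q : ℂ} (a b : ℕ) :
    qPochCIntInv q ((a + b : ℕ) : ℤ) b * qPochC q q a = qPochC q q (a + b) := by
  induction b with
  | zero => simp [qPochCIntInv]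
  | succ b ih =>
    rw [← add_assoc, qPochC_succ, ← ih, qPochCIntInv, Finset.prod_range_succ', qPochCIntInv]
    have h : ∀ i : ℕ, ((a + b + 1 : ℕ) : ℤ) - ((i + 1 : ℕ) : ℤ) = ((a + b : ℕ) : ℤ) - i := by
      intro i; push_cast; ring
    simp only [h, Nat.cast_zero, sub_zero, zpow_natCast, pow_succ']
    ring

theorem qPochC_zpow {q : ℂ} (hq : q ≠ 0) (s : ℤ) (n : ℕ) :
    qPochC q (q ^ s) n = qPochCInt q s n :=
  Finset.prod_congr rfl fun i _ => by rw [zpow_add₀ hq, zpow_natCast]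

theorem circleIntegrable_zpow {r : ℝ} (hr : 0 < r) (n : ℤ) :
    CircleIntegrable (fun w : ℂ => w ^ n) 0 r := by
  have := (circleIntegrable_sub_zpow_iff (c := 0) (w := 0) (R := r) (n := n)).2
    (Or.inr (Or.inr (by simp [abs_of_pos hr, hr.ne])))
  simpa using this

theorem circleIntegral_zpow {r : ℝ} (hr : 0 < r) (n : ℤ) :
    (∮ w in C(0, r), w ^ (n - 1)) = if n = 0 then 2 * (Real.pi : ℂ) * Complex.I else 0 := by
  split_ifs with h
  · subst h
    simpa [zpow_neg_one] using circleIntegral.integral_sub_center_inv (0 : ℂ) hr.ne'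
  · simpa using circleIntegral.integral_sub_zpow_of_ne (n := n - 1) (by omega) 0 0 r

/-- The constant coefficient of a product of a polynomial in `w⁻¹`, a polynomial in `w` and a
power of `w`, extracted by a contour integral. -/
theorem circleIntegral_zpow_mul_sum_mul_sum {r : ℝ} (hr : 0 < r) (s : ℤ) (J K : ℕ)
    (a b : ℕ → ℂ) :
    (2 * (Real.pi : ℂ) * Complex.I)⁻¹ * (∮ w in C(0, r), w ^ s *
      (∑ j ∈ Finset.range J, a j * w ^ (-(j : ℤ))) * (∑ k ∈ Finset.range K, b k * w ^ k) / w)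
      = ∑ k ∈ Finset.range K, ∑ j ∈ Finset.range J, if s - j + k = 0 then a j * b k else 0 := by
  have h : (∮ w in C(0, r), w ^ s * (∑ j ∈ Finset.range J, a j * w ^ (-(j : ℤ))) *
      (∑ k ∈ Finset.range K, b k * w ^ k) / w) = ∮ w in C(0, r),
      ∑ k ∈ Finset.range K, ∑ j ∈ Finset.range J, a j * b k * w ^ (s - j + k - 1) := by
    refine circleIntegral.integral_congr hr.le fun w hw => ?_
    have hw0 : w ≠ 0 := by
      rintro rfl
      simp [hr.ne] at hw
    simp only [Finset.sum_mul, Finset.mul_sum, Finset.sum_div]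
    refine Finset.sum_congr rfl fun k _ => Finset.sum_congr rfl fun j _ => ?_
    rw [zpow_sub_one₀ hw0, zpow_add₀ hw0, sub_eq_add_neg, zpow_add₀ hw0, zpow_natCast]
    ring
  have hi : ∀ k j : ℕ, CircleIntegrable (fun w : ℂ => a j * b k * w ^ (s - j + k - 1)) 0 r :=
    fun k j => (circleIntegrable_zpow hr _).const_mul _
  rw [h, circleIntegral.integral_fun_sum fun k _ => CircleIntegrable.fun_sum _ fun j _ => hi k j,
    Finset.mul_sum]
  refine Finset.sum_congr rfl fun k _ => ?_
  rw [circleIntegral.integral_fun_sum fun j _ => hi k j, Finset.mul_sum]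
  refine Finset.sum_congr rfl fun j _ => ?_
  rw [circleIntegral.integral_const_mul, circleIntegral_zpow hr]
  split_ifs
  · have := Complex.two_pi_I_ne_zero
    field_simp
  · simp

/-- The residue extraction: `(1/2πi) ∮_{|w|=r} G_N(w) dw/w` equals the indicator term
`1_{t₂>t₁} q^{−t₂(p₁−p₂)} (q^{p₁−p₂+1};q)_{t₂−t₁−1}/(q;q)_{t₂−t₁−1}`, for every `r > 0`. -/
theorem stmt_6 (q : ℝ) (hq0 : 0 < q) (hq1 : q < 1) (t₁ t₂ : ℕ) (ht₂ : 1 ≤ t₂)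
    (p₁ p₂ : ℤ) (N : ℕ) (hN : t₁ + t₂ + 2 ≤ N) (r : ℝ) (hr : 0 < r) :
    (2 * (Real.pi : ℂ) * Complex.I)⁻¹ *
        (∮ w in C(0, r), GN (q : ℂ) N t₁ t₂ p₁ p₂ w / w)
      = if t₁ < t₂ then
          (q : ℂ) ^ (-(t₂ : ℤ) * (p₁ - p₂)) *
            qPochCInt (q : ℂ) (p₁ - p₂ + 1) (t₂ - t₁ - 1) / qPochC (q : ℂ) (q : ℂ) (t₂ - t₁ - 1)
        else 0 := by
  have hqc : (q : ℂ) ≠ 0 := by exact_mod_cast hq0.ne'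
  have hP := qPochC_self_ne_zero hq0 hq1
  generalize (q : ℂ) = x at hqc hP ⊢
  obtain ⟨M, rfl⟩ : ∃ M, t₂ = M + 1 := ⟨t₂ - 1, by omega⟩
  let a : ℕ → ℂ := fun j => qPochCIntInv x ((N : ℤ) - 1) t₁ *
    ((qPochCIntInv x ((N : ℤ) - t₁ - 1) j / qPochCIntInv x ((N : ℤ) - 1) j) * x ^ ((j : ℤ) * p₁))
  let b : ℕ → ℂ := fun k => x ^ (p₂ * (M + 1 : ℕ) - N * p₁) *
    (qPochCoeff x M k * (x ^ (1 - p₂)) ^ k) / qPochC x x M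
  have hG : ∀ w, GN x N t₁ (M + 1) p₁ p₂ w = w ^ ((N : ℤ) - (M + 1 : ℕ)) *
      (∑ j ∈ Finset.range (N - t₁), a j * w ^ (-(j : ℤ))) *
      (∑ k ∈ Finset.range (M + 1), b k * w ^ k) := by
    intro w
    have ha : ∑ j ∈ Finset.range (N - t₁), a j * w ^ (-(j : ℤ))
        = qPochCIntInv x ((N : ℤ) - 1) t₁ * PhiN x N t₁ p₁ w := by
      simp only [a, PhiN, Finset.mul_sum, mul_assoc]
    have hb : ∑ k ∈ Finset.range (M + 1), b k * w ^ k = x ^ (p₂ * (M + 1 : ℕ) - N * p₁) *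
        qPochC x (w * x ^ (1 - p₂)) M / qPochC x x M := by
      rw [qPochC_eq_sum, Finset.mul_sum, Finset.sum_div]
      exact Finset.sum_congr rfl fun k _ => by simp only [b, mul_pow]; ring
    rw [ha, hb, GN, Nat.add_sub_cancel]
    ring
  simp only [hG]
  rw [circleIntegral_zpow_mul_sum_mul_sum hr]
  have hinner : ∀ k ∈ Finset.range (M + 1), (∑ j ∈ Finset.range (N - t₁),
      if (N : ℤ) - (M + 1 : ℕ) - j + k = 0 then a j * b k else 0)
      = if k + t₁ < M + 1 then a (N - (M + 1) + k) * b k else 0 := by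
    intro k _
    have hj : ∀ j : ℕ, (N : ℤ) - (M + 1 : ℕ) - j + k = 0 ↔ N - (M + 1) + k = j := by
      intro j; omega
    simp only [hj, Finset.sum_ite_eq, Finset.mem_range]
    exact if_congr (by omega) rfl rfl
  rw [Finset.sum_congr rfl hinner]
  split_ifs with ht
  swap
  · exact Finset.sum_eq_zero fun k _ => if_neg (by omega)
  obtain ⟨m, rfl⟩ : ∃ m, M = m + t₁ := ⟨M - t₁, by omega⟩
  obtain ⟨L, rfl⟩ : ∃ L, N = m + t₁ + 1 + L := ⟨N - (m + t₁ + 1), by omega⟩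
  have hm : m + t₁ + 1 - t₁ - 1 = m := by omega
  rw [hm, ← qPochC_zpow hqc, qPochC_eq_sum, Finset.mul_sum, Finset.sum_div,
    ← Finset.sum_subset (Finset.range_subset_range.2 (by omega : m + 1 ≤ m + t₁ + 1))
      fun k _ hk => if_neg (by simp at hk; omega)]
  refine Finset.sum_congr rfl fun k hk => ?_
  rw [Finset.mem_range] at hk
  rw [if_pos (by omega), Nat.add_sub_cancel_left]
  obtain ⟨l, rfl⟩ : ∃ l, m = k + l := ⟨m - k, by omega⟩
  -- all `q`-factorials reduce to values of `n ↦ (q;q)_n`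
  have e₁ := qPochCIntInv_mul_qPochC (q := x) (k + l + L) t₁
  have e₂ := qPochCIntInv_mul_qPochC (q := x) l (L + k)
  have e₃ := qPochCIntInv_mul_qPochC (q := x) (l + t₁) (L + k)
  have c₁ := qPochCoeff_mul_mul x k (l + t₁)
  have c₂ := qPochCoeff_mul_mul x k l
  rw [show ((k + l + L + t₁ : ℕ) : ℤ) = ((k + l + t₁ + 1 + L : ℕ) : ℤ) - 1 by push_cast; ring]
    at e₁
  rw [show ((l + (L + k) : ℕ) : ℤ) = ((k + l + t₁ + 1 + L : ℕ) : ℤ) - t₁ - 1 by push_cast; ring,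
    show l + (L + k) = k + l + L by ring] at e₂
  rw [show ((l + t₁ + (L + k) : ℕ) : ℤ) = ((k + l + t₁ + 1 + L : ℕ) : ℤ) - 1 by push_cast; ring,
    show l + t₁ + (L + k) = k + l + L + t₁ by ring] at e₃
  rw [← add_assoc] at c₁
  have hpow : x ^ (((L + k : ℕ) : ℤ) * p₁) *
      x ^ (p₂ * ((k + l + t₁ + 1 : ℕ) : ℤ) - ((k + l + t₁ + 1 + L : ℕ) : ℤ) * p₁) *
      (x ^ (1 - p₂)) ^ k
      = x ^ (-((k + l + t₁ + 1 : ℕ) : ℤ) * (p₁ - p₂)) * (x ^ (p₁ - p₂ + 1)) ^ k := by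
    rw [← zpow_natCast, ← zpow_natCast, ← zpow_mul, ← zpow_mul, ← zpow_add₀ hqc,
      ← zpow_add₀ hqc, ← zpow_add₀ hqc]
    congr 1
    push_cast
    ring
  rw [← eq_div_iff (hP _)] at e₁ e₂ e₃
  rw [mul_assoc, ← eq_div_iff (mul_ne_zero (hP _) (hP _))] at c₁ c₂
  simp only [a, b]
  rw [mul_div_assoc, mul_div_assoc, e₁, e₂, e₃, c₁, c₂]
  have h₁ := hP (k + l + L)
  have h₂ := hP (k + l + L + t₁)
  have h₃ := hP l
  have h₄ := hP (l + t₁)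
  have h₅ := hP k
  have h₆ := hP (k + l)
  have h₇ := hP (k + l + t₁)
  generalize x ^ (((L + k : ℕ) : ℤ) * p₁) = y₁ at *
  generalize x ^ (p₂ * ((k + l + t₁ + 1 : ℕ) : ℤ) - ((k + l + t₁ + 1 + L : ℕ) : ℤ) * p₁) = y₂ at *
  generalize (x ^ (1 - p₂)) ^ k = y₃ at *
  generalize x ^ (-((k + l + t₁ + 1 : ℕ) : ℤ) * (p₁ - p₂)) = y₄ at *
  generalize (x ^ (p₁ - p₂ + 1)) ^ k = y₅ at *
  field_simp
  linear_combination hpow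
end
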